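/- Let φ be a Sturmian coloring of a d-regular tree. If A_n ≠ S_n then A_n is always adjacent to S_n, and if B_n ≠ S_n then B_n is always adjacent to S_n. Moreover, for every n the classes S_n and C_n are always adjacent. -/

import Mathlib

open scoped Classical

noncomputable section

namespace Sturm

variable {V α : Type}

/-- `G` is a `d`-regular tree. -/
structure IsRegularTree (G : SimpleGraph V) (d : ℕ) : Prop where
  isTree : G.IsTree
  regular : ∀ v : V, (G.neighborSet v).ncard = d

/-- Color-preserving isomorphism of the `n`-balls centered at `x` and `y`,
sending center to center. -/
def BallEquiv (G : SimpleGraph V) (φ : V → α) (n : ℕ) (x y : V) : Prop :=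
  ∃ f : {z : V // G.dist x z ≤ n} ≃ {z : V // G.dist y z ≤ n},
    (∀ u v : {z : V // G.dist x z ≤ n}, G.Adj u.1 v.1 ↔ G.Adj (f u).1 (f v).1) ∧
    (∀ u : {z : V // G.dist x z ≤ n}, φ (f u).1 = φ u.1) ∧
    ((f ⟨x, by rw [SimpleGraph.dist_self]; exact Nat.zero_le n⟩).1 = y)

/-- The class of the `n`-ball at `x`, viewed as the set of all centers of equivalent balls. -/
def ballClass (G : SimpleGraph V) (φ : V → α) (n : ℕ) (x : V) : Set V :=
  {y | BallEquiv G φ n x y}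

/-- The set `B_n(φ)` of classes of `n`-balls occurring in `(T, φ)`. -/
def ballClasses (G : SimpleGraph V) (φ : V → α) (n : ℕ) : Set (Set V) :=
  {C | ∃ x, C = ballClass G φ n x}

/-- A coloring is Sturmian if its factor complexity is `n + 2`. -/
def IsSturmian (G : SimpleGraph V) (φ : V → α) : Prop :=
  ∀ n, (ballClasses G φ n).ncard = n + 2

/-- `x` is the center of a special `n`-ball. -/
def IsSpecialVert (G : SimpleGraph V) (φ : V → α) (n : ℕ) (x : V) : Prop :=
  ∃ y, BallEquiv G φ n x y ∧ ¬ BallEquiv G φ (n + 1) x y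

/-- `S` is a special class of `n`-balls: the restriction of two distinct classes of
`(n+1)`-balls. -/
def IsSpecialClass (G : SimpleGraph V) (φ : V → α) (n : ℕ) (S : Set V) : Prop :=
  ∃ x, S = ballClass G φ n x ∧ IsSpecialVert G φ n x

/-- The class `D` is always adjacent to the class `E`. -/
def AlwaysAdjTo (G : SimpleGraph V) (D E : Set V) : Prop :=
  ∀ x ∈ D, ∃ y, G.Adj x y ∧ y ∈ E

/-- The classes `D` and `E` are (always) adjacent. -/
def AlwaysAdj (G : SimpleGraph V) (D E : Set V) : Prop :=
  AlwaysAdjTo G D E ∧ AlwaysAdjTo G E D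

/-- The classes `D` and `E` can be adjacent. -/
def CanAdj (G : SimpleGraph V) (D E : Set V) : Prop :=
  ∃ x ∈ D, ∃ y ∈ E, G.Adj x y

/-- The number of neighbors of `x` lying in (i.e. being centers of balls of class) `E`. -/
def nbrCount (G : SimpleGraph V) (x : V) (E : Set V) : ℕ :=
  (G.neighborSet x ∩ E).ncard

/-- The data of the labels `S_n, C_n, A_n, B_n` for a Sturmian coloring, normalized as in
the paper: `S_0 = A_0 = [a]`, `B_0 = [b]`, `A_{n+1}` (resp. `B_{n+1}`) is always adjacent
to `A_n` (resp. `B_n`), and `A_{n+1}, B_{n+1}` are the two distinct extensions of `S_n`. -/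
structure Labeling (G : SimpleGraph V) (φ : V → α) (a b : α) where
  S : ℕ → Set V
  C : ℕ → Set V
  A : ℕ → Set V
  B : ℕ → Set V
  S_special : ∀ n, IsSpecialClass G φ n (S n)
  C_central : ∀ n, ∃ x, IsSpecialVert G φ (n + 1) x ∧ S (n + 1) = ballClass G φ (n + 1) x ∧
      C n = ballClass G φ n x
  A0_eq_S0 : A 0 = S 0
  A0_col : ∃ x, φ x = a ∧ A 0 = ballClass G φ 0 x
  B0_col : ∃ x, φ x = b ∧ B 0 = ballClass G φ 0 x
  A_ext : ∀ n, ∃ x, IsSpecialVert G φ n x ∧ S n = ballClass G φ n x ∧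
      A (n + 1) = ballClass G φ (n + 1) x
  B_ext : ∀ n, ∃ x, IsSpecialVert G φ n x ∧ S n = ballClass G φ n x ∧
      B (n + 1) = ballClass G φ (n + 1) x
  AB_ne : ∀ n, A (n + 1) ≠ B (n + 1)
  A_adj : ∀ n, AlwaysAdjTo G (A (n + 1)) (A n)
  B_adj : ∀ n, AlwaysAdjTo G (B (n + 1)) (B n)

/-- A cycle (of length `≥ 3`, with pairwise distinct vertices) in the graph `G_n` of
classes of `n`-balls, where classes are joined when they can be adjacent. -/
def IsCycleIn (G : SimpleGraph V) (φ : V → α) (n k : ℕ) (c : ℕ → Set V) : Prop :=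
  3 ≤ k ∧ (∀ i < k, c i ∈ ballClasses G φ n) ∧
    (∀ i < k, CanAdj G (c i) (c ((i + 1) % k))) ∧
    (∀ i < k, ∀ j < k, c i = c j → i = j)

/-- The graph `G_n` contains a cycle. -/
def HasCycle (G : SimpleGraph V) (φ : V → α) (n : ℕ) : Prop :=
  ∃ k c, IsCycleIn G φ n k c

/-! ## Edge-indexed colored graphs -/

/-- An edge-indexed graph, with vertices colored by `α` and labeled by classes
(sets of vertices of the underlying tree `V`). Index `0` means "no edge". -/
structure EIG (V α : Type) where
  Vert : Type
  idx : Vert → Vert → ℕ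
  col : Vert → α
  lab : Vert → Set V

/-- Isomorphism of colored edge-indexed graphs. -/
structure EIGIso (X Y : EIG V α) where
  e : X.Vert ≃ Y.Vert
  idx_eq : ∀ u v, Y.idx (e u) (e v) = X.idx u v
  col_eq : ∀ u, Y.col (e u) = X.col u

/-- The index `i_A(D, E)` (resp. `i_B`, `i`) at the level of classes: the number of
neighbors, in class `E`, of a representative center of `D`; when `D` is the special
class `Sp`, the representative is taken with extension of class `Ext`. -/
def classIdx (G : SimpleGraph V) (Sp Ext : Set V) (D E : Set V) : ℕ :=
  if D = Sp then (if h : Ext.Nonempty then nbrCount G h.some E else 0)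
  else (if h : D.Nonempty then nbrCount G h.some E else 0)

/-- The classes of `n`-balls joined to `Sp` by a path of edges of positive `J`-index. -/
def reachSet (G : SimpleGraph V) (φ : V → α) (n : ℕ) (Sp : Set V)
    (J : Set V → Set V → ℕ) : Set (Set V) :=
  {D | ∃ k, ∃ c : ℕ → Set V, c 0 = Sp ∧ c k = D ∧ (∀ i ≤ k, c i ∈ ballClasses G φ n) ∧
    ∀ i < k, 0 < J (c i) (c (i + 1)) ∨ 0 < J (c (i + 1)) (c i)}

/-- Color of a class: the color of (the center of) any of its representatives. -/
def colOf [Nonempty V] (φ : V → α) (D : Set V) : α :=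
  if h : D.Nonempty then φ h.some else φ (Classical.arbitrary V)

/-- The edge-indexed graph `G^A_n` (when `Ext = A_{n+1}`) resp. `G^B_n`. -/
def sideEIG [Nonempty V] (G : SimpleGraph V) (φ : V → α) (n : ℕ) (Sp Ext : Set V) :
    EIG V α where
  Vert := {D : Set V // D ∈ reachSet G φ n Sp (classIdx G Sp Ext)}
  idx := fun D E => classIdx G Sp Ext D.1 E.1
  col := fun D => colOf φ D.1
  lab := fun D => D.1

variable {G : SimpleGraph V} {φ : V → α} {a b : α}

/-- The edge-indexed graph `G^A_n`. -/
def GAeig [Nonempty V] (L : Labeling G φ a b) (n : ℕ) : EIG V α :=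
  sideEIG G φ n (L.S n) (L.A (n + 1))

/-- The edge-indexed graph `G^B_n`. -/
def GBeig [Nonempty V] (L : Labeling G φ a b) (n : ℕ) : EIG V α :=
  sideEIG G φ n (L.S n) (L.B (n + 1))

/-- Vertex set of `G^A_n`. -/
def VGAset (L : Labeling G φ a b) (n : ℕ) : Set (Set V) :=
  reachSet G φ n (L.S n) (classIdx G (L.S n) (L.A (n + 1)))

/-- Vertex set of `G^B_n`. -/
def VGBset (L : Labeling G φ a b) (n : ℕ) : Set (Set V) :=
  reachSet G φ n (L.S n) (classIdx G (L.S n) (L.B (n + 1)))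

/-- `G^A_n` or `G^B_n`, selected by a letter (`true = A`, `false = B`). -/
def GsideEIG [Nonempty V] (L : Labeling G φ a b) (n : ℕ) : Bool → EIG V α
  | true => GAeig L n
  | false => GBeig L n

/-- Vertex set of `G^A_n` or `G^B_n`, selected by a letter. -/
def VGside (L : Labeling G φ a b) (n : ℕ) : Bool → Set (Set V)
  | true => VGAset L n
  | false => VGBset L n

/-- A single vertex with a loop of index `d` (the graph `G^A_{-1} = G^B_{-1} = F^._{-1}`). -/
def baseEIG (V : Type) (x : α) (d : ℕ) : EIG V α where
  Vert := PUnit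
  idx := fun _ _ => d
  col := fun _ => x
  lab := fun _ => Set.univ

/-- `GAx L d (n+1) = G^A_n`, and `GAx L d 0 = G^A_{-1}`. -/
def GAx [Nonempty V] (L : Labeling G φ a b) (d : ℕ) : ℕ → EIG V α
  | 0 => baseEIG V a d
  | n + 1 => GAeig L n

/-- `GBx L d (n+1) = G^B_n`, and `GBx L d 0 = G^B_{-1}`. -/
def GBx [Nonempty V] (L : Labeling G φ a b) (d : ℕ) : ℕ → EIG V α
  | 0 => baseEIG V b d
  | n + 1 => GBeig L n

/-- `Cx L (n+1) = C_n`, and `Cx L 0 = C_{-1}` (the class of the empty ball). -/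
def Cx (L : Labeling G φ a b) : ℕ → Set V
  | 0 => Set.univ
  | n + 1 => L.C n

/-! ## Concatenations -/

/-- The `(i)`-concatenation of two edge-indexed graphs at the end vertices `v, v'`
(which are identified). -/
def concatI (X Y : EIG V α) (v : X.Vert) (v' : Y.Vert) (i : ℕ) : EIG V α where
  Vert := X.Vert ⊕ {w : Y.Vert // w ≠ v'}
  idx := fun p q =>
    match p, q with
    | Sum.inl u, Sum.inl w =>
        if u = v ∧ w ≠ v then (if X.idx u w = 0 then 0 else i) else X.idx u w
    | Sum.inl u, Sum.inr w => if u = v then Y.idx v' w.1 - i else 0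
    | Sum.inr w, Sum.inl u => if u = v then Y.idx w.1 v' else 0
    | Sum.inr w, Sum.inr w2 => Y.idx w.1 w2.1
  col := Sum.elim X.col (fun w => Y.col w.1)
  lab := Sum.elim X.lab (fun w => Y.lab w.1)

/-- The `(i,j)`-concatenation of two edge-indexed graphs at the end vertices `v, v'`
(which stay distinct, joined by a new edge of indices `i`, `j`). -/
def concatIJ (X Y : EIG V α) (v : X.Vert) (v' : Y.Vert) (i j : ℕ) : EIG V α where
  Vert := X.Vert ⊕ Y.Vert
  idx := fun p q =>
    match p, q with
    | Sum.inl u, Sum.inl w => if u = v ∧ w = v then X.idx v v - i else X.idx u w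
    | Sum.inl u, Sum.inr w => if u = v ∧ w = v' then i else 0
    | Sum.inr w, Sum.inl u => if w = v' ∧ u = v then j else 0
    | Sum.inr u, Sum.inr w => if u = v' ∧ w = v' then Y.idx v' v' - j else Y.idx u w
  col := Sum.elim X.col Y.col
  lab := Sum.elim X.lab Y.lab

/-- `Z` is a concatenation ((i)- or (i,j)-) of `X` and `Y` at `(vX, vY)`. -/
def IsConcatOfAt (Z X Y : EIG V α) (vX : X.Vert) (vY : Y.Vert) : Prop :=
  (∃ i, 1 ≤ i ∧ Nonempty (EIGIso Z (concatI X Y vX vY i))) ∨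
  (∃ i j, 1 ≤ i ∧ 1 ≤ j ∧ Nonempty (EIGIso Z (concatIJ X Y vX vY i j)))

/-! ## Paths, distance, degree in edge-indexed graphs -/

/-- Adjacency (by an edge of positive index, in one of the two orientations). -/
def EIGAdj (X : EIG V α) (u w : X.Vert) : Prop :=
  u ≠ w ∧ (0 < X.idx u w ∨ 0 < X.idx w u)

/-- There is a path of length `L` from `u` to `w`. -/
def EIGReach (X : EIG V α) (u w : X.Vert) (L : ℕ) : Prop :=
  ∃ c : ℕ → X.Vert, c 0 = u ∧ c L = w ∧ ∀ i < L, EIGAdj X (c i) (c (i + 1))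

/-- Graph distance in an edge-indexed graph. -/
def EIGDist (X : EIG V α) (u w : X.Vert) : ℕ :=
  sInf {L | EIGReach X u w L}

/-- `u` has degree one: there is exactly one vertex adjacent to it. -/
def EIGEndVert (X : EIG V α) (u : X.Vert) : Prop :=
  ∃! w, EIGAdj X u w

/-! ## Coverings, direct limits, quotient graph, bounded type -/

/-- `p` exhibits the graph `H` as the universal cover of the edge-indexed graph `Y`:
above a vertex mapping to `u`, the number of neighbors above `w` is the index `idx u w`. -/
def IsEIGCover {W : Type} (H : SimpleGraph W) (Y : EIG V α) (p : W → Y.Vert) : Prop :=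
  ∀ x : W, ∀ u : Y.Vert, (H.neighborSet x ∩ p ⁻¹' {u}).ncard = Y.idx (p x) u

/-- `Y` is the direct limit of the system `F` of colored edge-indexed graphs along the
inclusions `ι`. -/
def IsDirLimit (F : ℕ → EIG V α) (ι : ∀ k, (F k).Vert → (F (k + 1)).Vert)
    (Y : EIG V α) : Prop :=
  ∃ j : ∀ k, (F k).Vert → Y.Vert,
    (∀ k v, j (k + 1) (ι k v) = j k v) ∧
    (∀ k, Function.Injective (j k)) ∧
    (∀ y, ∃ k v, j k v = y) ∧
    (∀ k v, Y.col (j k v) = (F k).col v) ∧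
    (∀ y z : Y.Vert, ∃ N, ∀ k, N ≤ k → ∀ v w, j k v = y → j k w = z →
      Y.idx y z = (F k).idx v w)

/-- The coloring `φ` is of bounded type: every vertex has finite type set. -/
def BoundedType (G : SimpleGraph V) (φ : V → α) : Prop :=
  ∀ v : V, {m : ℕ | IsSpecialVert G φ m v}.Finite

/-- Two vertices are related if some color-preserving automorphism maps one to the other. -/
def colorOrbitRel (G : SimpleGraph V) (φ : V → α) (x y : V) : Prop :=
  ∃ g : V ≃ V, (∀ u w, G.Adj u w ↔ G.Adj (g u) (g w)) ∧ (∀ u, φ (g u) = φ u) ∧ g x = y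

/-- The quotient graph `X_φ = G\T` as a colored edge-indexed graph. -/
def quotEIG (G : SimpleGraph V) (φ : V → α) : EIG V α where
  Vert := Quot (colorOrbitRel G φ)
  idx := fun u w => (G.neighborSet u.out ∩ {z | Quot.mk (colorOrbitRel G φ) z = w}).ncard
  col := fun u => φ u.out
  lab := fun u => {z | Quot.mk (colorOrbitRel G φ) z = u}

/-! ## The sequences `n_k`, `α_k`, `β_k` -/

/-- At level `n`, one of `A_n, B_n` is `S_n` or `C_n`. -/
def SpecTouch (L : Labeling G φ a b) (n : ℕ) : Prop :=
  L.A n = L.S n ∨ L.A n = L.C n ∨ L.B n = L.S n ∨ L.B n = L.C n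

/-- `nk` is the increasing enumeration of the levels where `SpecTouch` holds. -/
def IsNkSeq (L : Labeling G φ a b) (nk : ℕ → ℕ) : Prop :=
  StrictMono nk ∧ ∀ n, (∃ k, nk k = n) ↔ SpecTouch L n

/-- `αs` is the sequence `α_k`: `α_K = A`, and for `k ≠ K`, `α_k` is the side whose
graph `G^{α_k}_{n_k}` has more vertices. -/
def IsAlphaSeq (L : Labeling G φ a b) (nk : ℕ → ℕ) (K : ℕ∞) (αs : ℕ → Bool) : Prop :=
  ∀ k : ℕ, ((k : ℕ∞) = K → αs k = true) ∧
    ((k : ℕ∞) ≠ K → (αs k = true ↔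
      (VGside L (nk k) false).ncard < (VGside L (nk k) true).ncard))

/-- The sequence `β_k(t)`: `β_{k-1}(t)` is the letter `ᾱ_k` if the class of the
`n_k`-ball at `t` is a vertex of `G^{ᾱ_k}_{n_k}`, and `α_k` otherwise. -/
def betaOf (L : Labeling G φ a b) (nk : ℕ → ℕ) (αs : ℕ → Bool) (t : V) (k : ℕ) : Bool :=
  if ballClass G φ (nk (k + 1)) t ∈ VGside L (nk (k + 1)) (!(αs (k + 1))) then
    !(αs (k + 1))
  else αs (k + 1)

end Sturm

namespace Sturm

section BallEquiv

variable {V α : Type} {G : SimpleGraph V} {φ : V → α} {n m k : ℕ} {x y z : V}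

theorem BallEquiv.refl (x : V) : BallEquiv G φ n x x :=
  ⟨Equiv.refl _, fun _ _ => Iff.rfl, fun _ => rfl, rfl⟩

theorem BallEquiv.symm (h : BallEquiv G φ n x y) : BallEquiv G φ n y x := by
  obtain ⟨f, hadj, hcol, hc⟩ := h
  refine ⟨f.symm, fun u v => ?_, fun u => ?_, ?_⟩
  · simpa using (hadj (f.symm u) (f.symm v)).symm
  · simpa using (hcol (f.symm u)).symm
  · have : f.symm ⟨y, by simp⟩ = ⟨x, by simp⟩ := by
      rw [Equiv.symm_apply_eq]
      exact Subtype.ext hc.symm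
    rw [this]

theorem BallEquiv.trans (h : BallEquiv G φ n x y) (h' : BallEquiv G φ n y z) :
    BallEquiv G φ n x z := by
  obtain ⟨f, hadj, hcol, hc⟩ := h
  obtain ⟨g, gadj, gcol, gc⟩ := h'
  refine ⟨f.trans g, fun u v => (hadj u v).trans (gadj _ _),
    fun u => (gcol _).trans (hcol u), ?_⟩
  rw [Equiv.trans_apply, show f ⟨x, _⟩ = ⟨y, by simp⟩ from Subtype.ext hc]
  exact gc

/-- A map between balls that preserves adjacency does not increase the length of walks that
cannot leave the ball. -/
theorem dist_map_le_walk_length (hG : G.Connected)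
    (f : {w : V // G.dist x w ≤ m} → {w : V // G.dist y w ≤ m})
    (hf : ∀ u v : {w : V // G.dist x w ≤ m}, G.Adj u.1 v.1 → G.Adj (f u).1 (f v).1)
    {u v : V} (p : G.Walk u v) (hp : G.dist x u + p.length ≤ m)
    (hu : G.dist x u ≤ m) (hv : G.dist x v ≤ m) :
    G.dist (f ⟨u, hu⟩).1 (f ⟨v, hv⟩).1 ≤ p.length := by
  induction p with
  | nil => simp
  | @cons u w v h p ih =>
    have huw : G.dist u w = 1 := SimpleGraph.dist_eq_one_iff_adj.2 h
    have hxw : G.dist x w ≤ G.dist x u + G.dist u w := hG.dist_triangle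
    rw [SimpleGraph.Walk.length_cons] at hp ⊢
    have hw : G.dist x w ≤ m := by omega
    have h1 := ih (by omega) hw hv
    have h2 : G.dist (f ⟨u, hu⟩).1 (f ⟨w, hw⟩).1 = 1 :=
      SimpleGraph.dist_eq_one_iff_adj.2 (hf ⟨u, hu⟩ ⟨w, hw⟩ h)
    have h3 : G.dist (f ⟨u, hu⟩).1 (f ⟨v, hv⟩).1 ≤ _ + G.dist (f ⟨w, hw⟩).1 (f ⟨v, hv⟩).1 :=
      hG.dist_triangle
    omega

theorem dist_map_le (hG : G.Connected)
    (f : {w : V // G.dist x w ≤ m} → {w : V // G.dist y w ≤ m})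
    (hf : ∀ u v : {w : V // G.dist x w ≤ m}, G.Adj u.1 v.1 → G.Adj (f u).1 (f v).1)
    (u v : {w : V // G.dist x w ≤ m}) (h : G.dist x u.1 + G.dist u.1 v.1 ≤ m) :
    G.dist (f u).1 (f v).1 ≤ G.dist u.1 v.1 := by
  obtain ⟨p, hp⟩ := hG.exists_walk_length_eq_dist u.1 v.1
  rw [← hp] at h ⊢
  exact dist_map_le_walk_length hG f hf p h u.2 v.2

/-- An equivalence of balls restricts to equivalences of the smaller balls contained in them. -/
theorem BallEquiv.exists_of_dist_add_le (hG : G.Connected) (h : BallEquiv G φ m x y)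
    (hz : G.dist x z + k ≤ m) :
    ∃ w, (z = x → w = y) ∧ (G.Adj x z → G.Adj y w) ∧ BallEquiv G φ k z w := by
  obtain ⟨f, hadj, hcol, hc⟩ := h
  have hzm : G.dist x z ≤ m := by omega
  have hfx : f ⟨x, by simp⟩ = ⟨y, by simp⟩ := Subtype.ext hc
  have hf : ∀ u v : {w : V // G.dist x w ≤ m}, G.Adj u.1 v.1 → G.Adj (f u).1 (f v).1 :=
    fun u v => (hadj u v).1
  have hf' : ∀ u v : {w : V // G.dist y w ≤ m},
      G.Adj u.1 v.1 → G.Adj (f.symm u).1 (f.symm v).1 :=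
    fun u v huv => (hadj _ _).2 (by simpa using huv)
  have hyw : G.dist y (f ⟨z, hzm⟩).1 ≤ G.dist x z := by
    have := dist_map_le hG f hf ⟨x, by simp⟩ ⟨z, hzm⟩ (by simpa using hzm)
    rwa [hfx] at this
  have hxv : ∀ v, G.dist z v ≤ k → G.dist x v ≤ m := fun v hv =>
    (hG.dist_triangle (v := z)).trans (by omega)
  have hyv : ∀ v, G.dist (f ⟨z, hzm⟩).1 v ≤ k → G.dist y v ≤ m := fun v hv =>
    (hG.dist_triangle (v := (f ⟨z, hzm⟩).1)).trans (by omega)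
  refine ⟨(f ⟨z, hzm⟩).1, ?_, ?_, ⟨⟨fun v => ⟨(f ⟨v.1, hxv _ v.2⟩).1, ?_⟩,
    fun v => ⟨(f.symm ⟨v.1, hyv _ v.2⟩).1, ?_⟩, fun v => ?_, fun v => ?_⟩, ?_, ?_, ?_⟩⟩
  · rintro rfl
    exact hc
  · intro h
    have := hf ⟨x, by simp⟩ ⟨z, hzm⟩ h
    rwa [hfx] at this
  · have hv := v.2
    exact (dist_map_le hG f hf ⟨z, hzm⟩ ⟨v.1, hxv _ v.2⟩ (by dsimp only; omega)).trans hv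
  · have hv := v.2
    have := dist_map_le hG f.symm hf' (f ⟨z, hzm⟩) ⟨v.1, hyv _ v.2⟩ (by dsimp only; omega)
    rw [Equiv.symm_apply_apply] at this
    exact this.trans hv
  · simp
  · simp
  · exact fun u v => hadj ⟨u.1, hxv _ u.2⟩ ⟨v.1, hxv _ v.2⟩
  · exact fun u => hcol ⟨u.1, hxv _ u.2⟩
  · rfl

theorem BallEquiv.of_succ (hG : G.Connected) (h : BallEquiv G φ (n + 1) x y) :
    BallEquiv G φ n x y := by
  obtain ⟨w, hw, -, hxw⟩ := h.exists_of_dist_add_le (k := n) hG (z := x) (by simp)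
  exact hw rfl ▸ hxw

theorem BallEquiv.exists_adj (hG : G.Connected) (h : BallEquiv G φ (n + 1) x y)
    (hz : G.Adj x z) : ∃ w, G.Adj y w ∧ BallEquiv G φ n z w := by
  obtain ⟨w, -, hw, hzw⟩ := h.exists_of_dist_add_le (k := n) hG (z := z)
    (by rw [SimpleGraph.dist_eq_one_iff_adj.2 hz, add_comm])
  exact ⟨w, hw hz, hzw⟩

theorem ballClass_eq_iff : ballClass G φ n x = ballClass G φ n y ↔ BallEquiv G φ n x y := by
  refine ⟨fun h => ?_, fun h => ?_⟩
  · have : y ∈ ballClass G φ n y := BallEquiv.refl y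
    rwa [← h] at this
  · ext w
    exact ⟨h.symm.trans, h.trans⟩

theorem BallEquiv.exists_adj_mem (hG : G.Connected) (h : BallEquiv G φ (n + 1) x y)
    (hz : ∃ w, G.Adj x w ∧ w ∈ ballClass G φ n z) :
    ∃ w, G.Adj y w ∧ w ∈ ballClass G φ n z := by
  obtain ⟨w, hxw, hw⟩ := hz
  obtain ⟨v, hyv, hv⟩ := h.exists_adj hG hxw
  exact ⟨v, hyv, BallEquiv.trans hw hv⟩

/-- Only one pair of distinct classes of `(n+1)`-balls shares its central `n`-ball: a member of
such a pair occurs in every such pair. -/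
theorem IsSturmian.equiv_or_equiv (hSt : IsSturmian G φ) (hG : G.Connected)
    {x x' y y' : V} (hx : BallEquiv G φ n x x') (hx' : ¬ BallEquiv G φ (n + 1) x x')
    (hy : BallEquiv G φ n y y') (hy' : ¬ BallEquiv G φ (n + 1) y y') :
    BallEquiv G φ (n + 1) x y ∨ BallEquiv G φ (n + 1) x y' := by
  let r : Set V → Set V := fun D => {w | ∃ v ∈ D, BallEquiv G φ n v w}
  have hr : ∀ v, r (ballClass G φ (n + 1) v) = ballClass G φ n v := fun v => by
    ext w
    exact ⟨fun ⟨u, hu, huw⟩ => (BallEquiv.of_succ hG hu).trans huw,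
      fun hw => ⟨v, BallEquiv.refl v, hw⟩⟩
  let F := ballClasses G φ (n + 1) \ {ballClass G φ (n + 1) x}
  have hfin : (ballClasses G φ (n + 1)).Finite :=
    Set.finite_of_ncard_ne_zero (by rw [hSt]; omega)
  have hF : F.ncard = n + 2 := by
    rw [Set.ncard_sdiff_singleton_of_mem (show _ ∈ ballClasses G φ (n + 1) from ⟨x, rfl⟩), hSt]
    omega
  have himg : r '' F = ballClasses G φ n := by
    ext D
    constructor
    · rintro ⟨_, ⟨⟨v, rfl⟩, -⟩, rfl⟩
      exact ⟨v, hr v⟩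
    · rintro ⟨v, rfl⟩
      by_cases hv : BallEquiv G φ (n + 1) x v
      · refine ⟨ballClass G φ (n + 1) x', ⟨⟨x', rfl⟩, fun h => hx' ?_⟩, ?_⟩
        · exact (ballClass_eq_iff.1 h).symm
        · rw [hr, ballClass_eq_iff]
          exact hx.symm.trans (hv.of_succ hG)
      · exact ⟨_, ⟨⟨v, rfl⟩, fun h => hv (ballClass_eq_iff.1 h).symm⟩, hr v⟩
  have hinj : Set.InjOn r F :=
    Set.injOn_of_ncard_image_eq (by rw [himg, hSt, hF]) (hfin.subset Set.sdiff_subset)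
  by_contra! hc
  refine hy' (ballClass_eq_iff.1 (hinj ⟨⟨y, rfl⟩, fun h => hc.1 ?_⟩
    ⟨⟨y', rfl⟩, fun h => hc.2 ?_⟩ ?_))
  · exact (ballClass_eq_iff.1 h).symm
  · exact (ballClass_eq_iff.1 h).symm
  · rwa [hr, hr, ballClass_eq_iff]

/-- There is at most one special class of `n`-balls. -/
theorem IsSturmian.special_equiv (hSt : IsSturmian G φ) (hG : G.Connected)
    (hx : IsSpecialVert G φ n x) (hy : IsSpecialVert G φ n y) : BallEquiv G φ n x y := by
  obtain ⟨x', hx, hx'⟩ := hx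
  obtain ⟨y', hy, hy'⟩ := hy
  rcases hSt.equiv_or_equiv hG hx hx' hy hy' with h | h
  · exact h.of_succ hG
  · exact (h.of_succ hG).trans hy.symm

/-- A special ball has at most two extensions. -/
theorem IsSturmian.equiv_or_equiv_of_equiv (hSt : IsSturmian G φ) (hG : G.Connected)
    {x x' w : V} (hx : BallEquiv G φ n x x') (hx' : ¬ BallEquiv G φ (n + 1) x x')
    (hw : BallEquiv G φ n x w) :
    BallEquiv G φ (n + 1) x w ∨ BallEquiv G φ (n + 1) x' w := by
  by_cases h : BallEquiv G φ (n + 1) x w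
  · exact Or.inl h
  · rcases hSt.equiv_or_equiv hG hx.symm (fun h => hx' h.symm) hw h with h' | h'
    · exact absurd h'.symm hx'
    · exact Or.inr h'

/-- A non-special class that can be adjacent to a class is always adjacent to it. -/
theorem alwaysAdjTo_of_not_special (hG : G.Connected) {x z v : V}
    (hx : ¬ IsSpecialVert G φ n x) (hv : v ∈ ballClass G φ n x)
    (h : ∃ w, G.Adj v w ∧ w ∈ ballClass G φ n z) :
    AlwaysAdjTo G (ballClass G φ n x) (ballClass G φ n z) := by
  have key : ∀ u ∈ ballClass G φ n x, BallEquiv G φ (n + 1) x u := fun u hu => by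
    by_contra hc
    exact hx ⟨u, hu, hc⟩
  exact fun u hu => ((key v hv).symm.trans (key u hu)).exists_adj_mem hG h

end BallEquiv

section Labeling

variable {V α : Type} {G : SimpleGraph V} {φ : V → α} {a b : α}

/-- A class `D` of `n`-balls different from the special class is always adjacent to it as soon
as some extension of the special class is adjacent to `D`. -/
theorem IsSturmian.alwaysAdjTo_special (hSt : IsSturmian G φ) (hG : G.Connected) {n : ℕ}
    {D S E : Set V} (hD : D ∈ ballClasses G φ n) (hS : IsSpecialClass G φ n S)
    (hE : ∃ x, S = ballClass G φ n x ∧ E = ballClass G φ (n + 1) x)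
    (hED : AlwaysAdjTo G E D) (hne : D ≠ S) : AlwaysAdjTo G D S := by
  obtain ⟨z, rfl⟩ := hD
  obtain ⟨s, rfl, hs⟩ := hS
  obtain ⟨x, hx, rfl⟩ := hE
  obtain ⟨v, hxv, hv⟩ := hED x (BallEquiv.refl x)
  refine alwaysAdjTo_of_not_special hG (fun hz => hne ?_) hv
    ⟨x, hxv.symm, ballClass_eq_iff.1 hx⟩
  exact ballClass_eq_iff.2 (hSt.special_equiv hG hz hs)

theorem Labeling.S_subset_union (L : Labeling G φ a b) (hSt : IsSturmian G φ)
    (hG : G.Connected) (n : ℕ) : L.S n ⊆ L.A (n + 1) ∪ L.B (n + 1) := by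
  intro w hw
  obtain ⟨x, -, hSx, hx⟩ := L.A_ext n
  obtain ⟨y, -, hSy, hy⟩ := L.B_ext n
  have hne := L.AB_ne n
  rw [hx, hy, Ne, ballClass_eq_iff] at hne
  rw [hx, hy]
  rw [hSx] at hw
  exact hSt.equiv_or_equiv_of_equiv hG (ballClass_eq_iff.1 (hSx.symm.trans hSy)) hne hw

theorem Labeling.A_succ_subset (L : Labeling G φ a b) (hG : G.Connected) (n : ℕ) :
    L.A (n + 1) ⊆ L.S n := by
  obtain ⟨x, -, hS, hx⟩ := L.A_ext n
  rw [hS, hx]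
  exact fun w hw => BallEquiv.of_succ hG hw

theorem Labeling.B_succ_subset (L : Labeling G φ a b) (hG : G.Connected) (n : ℕ) :
    L.B (n + 1) ⊆ L.S n := by
  obtain ⟨x, -, hS, hx⟩ := L.B_ext n
  rw [hS, hx]
  exact fun w hw => BallEquiv.of_succ hG hw

theorem Labeling.A_mem_ballClasses (L : Labeling G φ a b) (n : ℕ) :
    L.A n ∈ ballClasses G φ n := by
  cases n with
  | zero => exact L.A0_col.imp fun _ h => h.2
  | succ n => exact (L.A_ext n).imp fun _ h => h.2.2

theorem Labeling.B_mem_ballClasses (L : Labeling G φ a b) (n : ℕ) :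
    L.B n ∈ ballClasses G φ n := by
  cases n with
  | zero => exact L.B0_col.imp fun _ h => h.2
  | succ n => exact (L.B_ext n).imp fun _ h => h.2.2

theorem Labeling.S_succ_subset_C (L : Labeling G φ a b) (hG : G.Connected) (n : ℕ) :
    L.S (n + 1) ⊆ L.C n := by
  obtain ⟨x, -, hS, hC⟩ := L.C_central n
  rw [hS, hC]
  exact fun w hw => BallEquiv.of_succ hG hw

theorem alwaysAdjTo_of_adj (hG : G.Connected) {n : ℕ} {D E F : Set V}
    (hD : D ∈ ballClasses G φ (n + 1)) (hE : E ∈ ballClasses G φ n)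
    (hF : F.Nonempty) (hFE : F ⊆ E) (hFD : AlwaysAdjTo G F D) : AlwaysAdjTo G D E := by
  obtain ⟨z, rfl⟩ := hD
  obtain ⟨e, rfl⟩ := hE
  obtain ⟨x, hx⟩ := hF
  obtain ⟨v, hxv, hv⟩ := hFD x hx
  exact fun u hu => BallEquiv.exists_adj_mem hG (BallEquiv.trans hv.symm hu)
    ⟨x, hxv.symm, hFE hx⟩

theorem nonempty_of_mem_ballClasses {n : ℕ} {D : Set V} (hD : D ∈ ballClasses G φ n) :
    D.Nonempty := by
  obtain ⟨x, rfl⟩ := hD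
  exact ⟨x, BallEquiv.refl x⟩

theorem Labeling.alwaysAdjTo_S_C (L : Labeling G φ a b) (hSt : IsSturmian G φ)
    (hG : G.Connected) (n : ℕ) : AlwaysAdjTo G (L.S n) (L.C n) := by
  have hC : L.C n ∈ ballClasses G φ n := (L.C_central n).imp fun _ h => h.2.2
  intro x hx
  rcases L.S_subset_union hSt hG n hx with h | h
  · exact alwaysAdjTo_of_adj hG (L.A_mem_ballClasses _) hC
      (nonempty_of_mem_ballClasses (L.A_mem_ballClasses _))
      ((L.A_succ_subset hG _).trans (L.S_succ_subset_C hG n)) (L.A_adj (n + 1)) x h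
  · exact alwaysAdjTo_of_adj hG (L.B_mem_ballClasses _) hC
      (nonempty_of_mem_ballClasses (L.B_mem_ballClasses _))
      ((L.B_succ_subset hG _).trans (L.S_succ_subset_C hG n)) (L.B_adj (n + 1)) x h

theorem Labeling.alwaysAdjTo_C_S (L : Labeling G φ a b) (hSt : IsSturmian G φ)
    (hG : G.Connected) (n : ℕ) : AlwaysAdjTo G (L.C n) (L.S n) := by
  by_cases hCS : L.C n = L.S n
  · have h := L.alwaysAdjTo_S_C hSt hG n
    rwa [hCS] at h ⊢
  · intro x hx
    have hxS : x ∈ L.S (n + 1) := by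
      obtain ⟨z, -, hS, hC⟩ := L.C_central n
      obtain ⟨s, hs, hsp⟩ := L.S_special n
      rw [hC] at hx
      rw [hS]
      by_contra hc
      refine hCS ?_
      rw [hC, hs, ballClass_eq_iff]
      exact hSt.special_equiv hG ⟨x, hx, hc⟩ hsp
    rcases L.S_subset_union hSt hG _ hxS with h | h
    · obtain ⟨y, hxy, hy⟩ := L.A_adj (n + 1) x h
      exact ⟨y, hxy, L.A_succ_subset hG n hy⟩
    · obtain ⟨y, hxy, hy⟩ := L.B_adj (n + 1) x h
      exact ⟨y, hxy, L.B_succ_subset hG n hy⟩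

end Labeling

/-- Lemma 2.2 (3), (4): if `A_n ≠ S_n` (resp. `B_n ≠ S_n`) then `A_n`
(resp. `B_n`) is always adjacent to `S_n`; moreover `S_n` and `C_n` are always adjacent. -/
theorem AB_always_adjacent_special {V α : Type} (G : SimpleGraph V) (d : ℕ) (hd : 3 ≤ d)
    (hT : IsRegularTree G d) (φ : V → α) (hSt : IsSturmian G φ)
    (a b : α) (hab : a ≠ b) (L : Labeling G φ a b) (n : ℕ) :
    (L.A n ≠ L.S n → AlwaysAdjTo G (L.A n) (L.S n)) ∧
    (L.B n ≠ L.S n → AlwaysAdjTo G (L.B n) (L.S n)) ∧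
    AlwaysAdj G (L.S n) (L.C n) := by
  have hG : G.Connected := hT.isTree.1
  exact ⟨hSt.alwaysAdjTo_special hG (L.A_mem_ballClasses n) (L.S_special n)
      ((L.A_ext n).imp fun _ h => h.2) (L.A_adj n),
    hSt.alwaysAdjTo_special hG (L.B_mem_ballClasses n) (L.S_special n)
      ((L.B_ext n).imp fun _ h => h.2) (L.B_adj n),
    L.alwaysAdjTo_S_C hSt hG n, L.alwaysAdjTo_C_S hSt hG n⟩

end Sturm
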